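/- Let A be a smooth finite idempotent algebra omitting type 1 and let C1, C2 be maximal components of Gs(A). Then there are a in C1 and b in C2 such that the pair (a,b) is a maximal element of the subalgebra of A×A generated by {(a,b),(b,a)}. -/

import Mathlib

/-! Common framework: universal algebras over a fixed signature, terms,
subalgebras, congruences, quotients, edges and their types (Bulatov's
coloured-graph approach), thin edges, connectivity, products, etc. -/

/-- A (functional) signature: a type of operation symbols with arities. -/
structure Signature where
  ops : Type
  arity : ops → ℕ

/-- An algebra of a given signature. -/
structure UAlgebra (σ : Signature) where
  carrier : Type
  interp : ∀ f : σ.ops, (Fin (σ.arity f) → carrier) → carrier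

/-- Terms over the signature `σ` in `n` variables. -/
inductive Term (σ : Signature) (n : ℕ) where
  | var : Fin n → Term σ n
  | app : (f : σ.ops) → (Fin (σ.arity f) → Term σ n) → Term σ n

/-- Evaluation of a term in an algebra; term operations of an algebra are
exactly the operations of the form `Term.eval A t`. -/
def Term.eval {σ : Signature} {n : ℕ} (A : UAlgebra σ) :
    Term σ n → (Fin n → A.carrier) → A.carrier
  | .var i, x => x i
  | .app f ts, x => A.interp f fun j => Term.eval A (ts j) x

namespace UAlgebra

variable {σ : Signature}

/-- An algebra is idempotent if all its basic operations are. -/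
def Idempotent (A : UAlgebra σ) : Prop :=
  ∀ (f : σ.ops) (a : A.carrier), A.interp f (fun _ => a) = a

/-- A set closed under all basic operations. -/
def IsClosed (A : UAlgebra σ) (S : Set A.carrier) : Prop :=
  ∀ (f : σ.ops) (x : Fin (σ.arity f) → A.carrier), (∀ j, x j ∈ S) → A.interp f x ∈ S

/-- Closure of a set under the basic operations. -/
inductive Closure (A : UAlgebra σ) (S : Set A.carrier) : A.carrier → Prop
  | base {a : A.carrier} : a ∈ S → Closure A S a
  | app (f : σ.ops) (x : Fin (σ.arity f) → A.carrier) :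
      (∀ j, Closure A S (x j)) → Closure A S (A.interp f x)

def ClosureSet (A : UAlgebra σ) (S : Set A.carrier) : Set A.carrier := {x | Closure A S x}

theorem closureSet_isClosed (A : UAlgebra σ) (S : Set A.carrier) :
    A.IsClosed (A.ClosureSet S) := fun f x h => Closure.app f x h

/-- The subalgebra of `A` on a closed subset `S`. -/
def subalg (A : UAlgebra σ) (S : Set A.carrier) (hS : A.IsClosed S) : UAlgebra σ where
  carrier := {x : A.carrier // x ∈ S}
  interp f x := ⟨A.interp f fun j => (x j : A.carrier), hS f _ fun j => (x j).2⟩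

/-- The subalgebra generated by a set `S`. -/
def Sg (A : UAlgebra σ) (S : Set A.carrier) : UAlgebra σ :=
  A.subalg (A.ClosureSet S) (A.closureSet_isClosed S)

/-- `a` as an element of `Sg {a, b}`. -/
def sgA (A : UAlgebra σ) (a b : A.carrier) : (A.Sg {a, b}).carrier :=
  ⟨a, Closure.base (Set.mem_insert a {b})⟩

/-- `b` as an element of `Sg {a, b}`. -/
def sgB (A : UAlgebra σ) (a b : A.carrier) : (A.Sg {a, b}).carrier :=
  ⟨b, Closure.base (Set.mem_insert_iff.mpr (Or.inr rfl))⟩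

/-- A congruence of an algebra. -/
structure Congruence (A : UAlgebra σ) where
  rel : A.carrier → A.carrier → Prop
  refl : ∀ x, rel x x
  symm : ∀ {x y}, rel x y → rel y x
  trans : ∀ {x y z}, rel x y → rel y z → rel x z
  compat : ∀ (f : σ.ops) (x y : Fin (σ.arity f) → A.carrier),
      (∀ j, rel (x j) (y j)) → rel (A.interp f x) (A.interp f y)

def Congruence.toSetoid {A : UAlgebra σ} (θ : Congruence A) : Setoid A.carrier :=
  ⟨θ.rel, ⟨θ.refl, θ.symm, θ.trans⟩⟩

/-- The full congruence. -/
def Congruence.IsFull {A : UAlgebra σ} (θ : Congruence A) : Prop := ∀ x y, θ.rel x y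

def Congruence.le {A : UAlgebra σ} (θ η : Congruence A) : Prop :=
  ∀ x y, θ.rel x y → η.rel x y

/-- A maximal congruence: proper, and any congruence above it is full or below it. -/
def Congruence.IsMaximal {A : UAlgebra σ} (θ : Congruence A) : Prop :=
  ¬ θ.IsFull ∧ ∀ η : Congruence A, θ.le η → ¬ η.IsFull → η.le θ

/-- The quotient (factor) algebra. -/
noncomputable def quot (A : UAlgebra σ) (θ : Congruence A) : UAlgebra σ where
  carrier := Quotient θ.toSetoid
  interp f x := Quotient.mk θ.toSetoid (A.interp f fun j => (x j).out)

/-- The class of `a` in the quotient of `Sg {a,b}` by `θ`. -/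
def qa (A : UAlgebra σ) (a b : A.carrier) (θ : Congruence (A.Sg {a, b})) :
    ((A.Sg {a, b}).quot θ).carrier :=
  Quotient.mk θ.toSetoid (A.sgA a b)

def qb (A : UAlgebra σ) (a b : A.carrier) (θ : Congruence (A.Sg {a, b})) :
    ((A.Sg {a, b}).quot θ).carrier :=
  Quotient.mk θ.toSetoid (A.sgB a b)

end UAlgebra

/-- A binary operation is a semilattice operation on a set `B`. -/
def IsSemilatticeOn {α : Type} (f : α → α → α) (B : Set α) : Prop :=
  (∀ x ∈ B, f x x = x) ∧ (∀ x ∈ B, ∀ y ∈ B, f x y = f y x) ∧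
    (∀ x ∈ B, ∀ y ∈ B, ∀ z ∈ B, f x (f y z) = f (f x y) z)

/-- A ternary operation is a majority operation on a set `B`. -/
def IsMajorityOn {α : Type} (g : α → α → α → α) (B : Set α) : Prop :=
  ∀ x ∈ B, ∀ y ∈ B, g x x y = x ∧ g x y x = x ∧ g y x x = x

/-- A ternary operation is a Mal'tsev operation on a set `B`. -/
def IsMaltsevOn {α : Type} (h : α → α → α → α) (B : Set α) : Prop :=
  ∀ x ∈ B, ∀ y ∈ B, h x y y = x ∧ h y y x = x

namespace UAlgebra

variable {σ : Signature}

/-- An algebra is "a set": every term operation is a projection. -/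
def IsSetAlgebra (Q : UAlgebra σ) : Prop :=
  ∀ (n : ℕ) (t : Term σ n), ∃ i : Fin n, ∀ x : Fin n → Q.carrier, t.eval Q x = x i

/-- An algebra is the full idempotent reduct of a module over some finite ring:
its term operations are exactly the idempotent affine combinations; in
particular the affine operation `x - y + z` is a term operation. -/
def IsAffineAlgebra (Q : UAlgebra σ) : Prop :=
  ∃ (R : Type) (_ : Ring R) (_ : Finite R) (_ : AddCommGroup Q.carrier)
    (_ : Module R Q.carrier),
    (∀ (n : ℕ) (g : (Fin n → Q.carrier) → Q.carrier),
      (∃ t : Term σ n, ∀ x, t.eval Q x = g x) ↔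
      (∃ c : Fin n → R, (∑ i, c i) = 1 ∧ ∀ x, g x = ∑ i, c i • x i)) ∧
    (∃ t : Term σ 3, ∀ x y z : Q.carrier, t.eval Q ![x, y, z] = x - y + z)

/-- `θ` witnesses that `ab` is an edge of the unary type. -/
def UnaryWitness (A : UAlgebra σ) (a b : A.carrier) (θ : Congruence (A.Sg {a, b})) : Prop :=
  θ.IsMaximal ∧ IsSetAlgebra ((A.Sg {a, b}).quot θ)

/-- `θ` witnesses that `ab` is an edge of the semilattice type. -/
def SLWitness (A : UAlgebra σ) (a b : A.carrier) (θ : Congruence (A.Sg {a, b})) : Prop :=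
  θ.IsMaximal ∧ ∃ t : Term σ 2,
    IsSemilatticeOn (fun x y => t.eval ((A.Sg {a, b}).quot θ) ![x, y])
      {A.qa a b θ, A.qb a b θ}

/-- `θ` witnesses that `ab` is an edge of the majority type. -/
def MajWitness (A : UAlgebra σ) (a b : A.carrier) (θ : Congruence (A.Sg {a, b})) : Prop :=
  θ.IsMaximal ∧
  (∃ t : Term σ 3,
    IsMajorityOn (fun x y z => t.eval ((A.Sg {a, b}).quot θ) ![x, y, z])
      {A.qa a b θ, A.qb a b θ}) ∧
  ¬ (∃ t : Term σ 2,
    IsSemilatticeOn (fun x y => t.eval ((A.Sg {a, b}).quot θ) ![x, y])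
      {A.qa a b θ, A.qb a b θ})

/-- `θ` witnesses that `ab` is an edge of the affine type. -/
def AffWitness (A : UAlgebra σ) (a b : A.carrier) (θ : Congruence (A.Sg {a, b})) : Prop :=
  θ.IsMaximal ∧ IsAffineAlgebra ((A.Sg {a, b}).quot θ)

/-- A pair of distinct elements is an edge. -/
def IsEdge (A : UAlgebra σ) (a b : A.carrier) : Prop :=
  a ≠ b ∧ ∃ θ : Congruence (A.Sg {a, b}), ¬ θ.IsFull ∧
    (IsSetAlgebra ((A.Sg {a, b}).quot θ) ∨
     IsAffineAlgebra ((A.Sg {a, b}).quot θ) ∨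
     (∃ t : Term σ 2,
        IsSemilatticeOn (fun x y => t.eval ((A.Sg {a, b}).quot θ) ![x, y])
          {A.qa a b θ, A.qb a b θ}) ∨
     (∃ t : Term σ 3,
        IsMajorityOn (fun x y z => t.eval ((A.Sg {a, b}).quot θ) ![x, y, z])
          {A.qa a b θ, A.qb a b θ}))

def IsUnaryEdge (A : UAlgebra σ) (a b : A.carrier) : Prop :=
  a ≠ b ∧ ∃ θ : Congruence (A.Sg {a, b}), UnaryWitness A a b θ

def IsSLEdge (A : UAlgebra σ) (a b : A.carrier) : Prop :=
  a ≠ b ∧ ∃ θ : Congruence (A.Sg {a, b}), SLWitness A a b θ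

def IsMajEdge (A : UAlgebra σ) (a b : A.carrier) : Prop :=
  a ≠ b ∧ ∃ θ : Congruence (A.Sg {a, b}), MajWitness A a b θ

def IsAffEdge (A : UAlgebra σ) (a b : A.carrier) : Prop :=
  a ≠ b ∧ ∃ θ : Congruence (A.Sg {a, b}), AffWitness A a b θ

end UAlgebra

/-- The four types of edges. -/
inductive EdgeType where
  | unary | semilattice | majority | affine
deriving DecidableEq

namespace UAlgebra

variable {σ : Signature}

def HasEdgeOfType (A : UAlgebra σ) (τ : EdgeType) (a b : A.carrier) : Prop :=
  match τ with
  | .unary => A.IsUnaryEdge a b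
  | .semilattice => A.IsSLEdge a b
  | .majority => A.IsMajEdge a b
  | .affine => A.IsAffEdge a b

/-- `T`-restricted algebra: every edge has a type from `T`. -/
def Restricted (A : UAlgebra σ) (T : Set EdgeType) : Prop :=
  ∀ a b : A.carrier, A.IsEdge a b → ∃ τ ∈ T, A.HasEdgeOfType τ a b

/-- `A` omits type 1: no subalgebra of `A` has an edge of the unary type. -/
def OmitsType1 (A : UAlgebra σ) : Prop :=
  ∀ (S : Set A.carrier) (hS : A.IsClosed S) (a b : (A.subalg S hS).carrier),
    ¬ (A.subalg S hS).IsUnaryEdge a b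

/-- The union of the two `θ`-blocks of a thick edge, as a subset of `A`. -/
def edgeBlockUnion (A : UAlgebra σ) (a b : A.carrier) (θ : Congruence (A.Sg {a, b})) :
    Set A.carrier :=
  {x | ∃ hx : x ∈ A.ClosureSet {a, b},
    θ.rel ⟨x, hx⟩ (A.sgA a b) ∨ θ.rel ⟨x, hx⟩ (A.sgB a b)}

/-- Smooth algebra: for every semilattice- or majority-type edge with a witnessing
maximal congruence, the union of the two blocks is a subuniverse. -/
def IsSmooth (A : UAlgebra σ) : Prop :=
  ∀ (a b : A.carrier) (θ : Congruence (A.Sg {a, b})),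
    (SLWitness A a b θ ∨ MajWitness A a b θ) → A.IsClosed (A.edgeBlockUnion a b θ)

def SemilatticeFree (A : UAlgebra σ) : Prop := ∀ a b : A.carrier, ¬ A.IsSLEdge a b
def MajorityFree (A : UAlgebra σ) : Prop := ∀ a b : A.carrier, ¬ A.IsMajEdge a b
def AffineFree (A : UAlgebra σ) : Prop := ∀ a b : A.carrier, ¬ A.IsAffEdge a b

/-- Thin semilattice edge. -/
def IsThinSLEdge (A : UAlgebra σ) (a b : A.carrier) : Prop :=
  ∃ t : Term σ 2, t.eval A ![a, a] = a ∧ t.eval A ![a, b] = b ∧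
    t.eval A ![b, a] = b ∧ t.eval A ![b, b] = b

/-- Undirected thin majority edge: some term operation is majority on `{a, b}`. -/
def IsUndirThinMajEdge (A : UAlgebra σ) (a b : A.carrier) : Prop :=
  ∃ t : Term σ 3, IsMajorityOn (fun x y z => t.eval A ![x, y, z]) {a, b}

/-- Mal'tsev edge: some term operation is Mal'tsev on `{a, b}`. -/
def IsMaltsevEdge (A : UAlgebra σ) (a b : A.carrier) : Prop :=
  ∃ t : Term σ 3, IsMaltsevOn (fun x y z => t.eval A ![x, y, z]) {a, b}

/-- The class of all quotients of subalgebras of `A`. -/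
def QuotSub (A : UAlgebra σ) : Set (UAlgebra σ) :=
  {B | ∃ (S : Set A.carrier) (hS : A.IsClosed S)
        (θ : Congruence (A.subalg S hS)), B = (A.subalg S hS).quot θ}

end UAlgebra

/-- The class of all quotients of subalgebras of the algebras of a class. -/
def QuotSubClass {σ : Signature} (K : Set (UAlgebra σ)) : Set (UAlgebra σ) :=
  {B | ∃ A ∈ K, B ∈ UAlgebra.QuotSub A}

/-- A ternary term satisfies the majority condition relative to a class `𝒦`. -/
def MajorityCondition {σ : Signature} (𝒦 : Set (UAlgebra σ)) (t : Term σ 3) : Prop :=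
  (∀ B ∈ 𝒦, ∀ x y : B.carrier,
    t.eval B ![x, t.eval B ![x, y, y], t.eval B ![x, y, y]] = t.eval B ![x, y, y]) ∧
  (∀ B ∈ 𝒦, ∀ (a b : B.carrier) (θ : UAlgebra.Congruence (B.Sg {a, b})),
    a ≠ b → UAlgebra.MajWitness B a b θ →
    IsMajorityOn (fun x y z => t.eval ((B.Sg {a, b}).quot θ) ![x, y, z])
      {B.qa a b θ, B.qb a b θ})

/-- A ternary term satisfies the minority condition relative to a class `𝒦`. -/
def MinorityCondition {σ : Signature} (𝒦 : Set (UAlgebra σ)) (t : Term σ 3) : Prop :=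
  (∀ B ∈ 𝒦, ∀ x y : B.carrier,
    t.eval B ![t.eval B ![x, y, y], y, y] = t.eval B ![x, y, y]) ∧
  (∀ B ∈ 𝒦, ∀ (a b : B.carrier) (θ : UAlgebra.Congruence (B.Sg {a, b})),
    a ≠ b → UAlgebra.AffWitness B a b θ →
    IsMaltsevOn (fun x y z => t.eval ((B.Sg {a, b}).quot θ) ![x, y, z])
      {B.qa a b θ, B.qb a b θ})

/-- Thin majority edge relative to a class `𝒦`. -/
def IsThinMajEdge {σ : Signature} (𝒦 : Set (UAlgebra σ)) (A : UAlgebra σ)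
    (a b : A.carrier) : Prop :=
  ∀ t : Term σ 3, MajorityCondition 𝒦 t →
    b ∈ A.ClosureSet {a, t.eval A ![a, b, b]} ∧
    b ∈ A.ClosureSet {a, t.eval A ![b, a, b]} ∧
    b ∈ A.ClosureSet {a, t.eval A ![b, b, a]}

/-- Thin affine edge relative to a class `𝒦` (with respect to some fixed term
operation satisfying the minority condition). -/
def IsThinAffEdge {σ : Signature} (𝒦 : Set (UAlgebra σ)) (A : UAlgebra σ)
    (a b : A.carrier) : Prop :=
  (∃ t : Term σ 3, MinorityCondition 𝒦 t ∧ t.eval A ![b, a, a] = b) ∧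
  ∀ t : Term σ 3, MinorityCondition 𝒦 t → b ∈ A.ClosureSet {a, t.eval A ![a, a, b]}

namespace UAlgebra

variable {σ : Signature}

/-- Reachability in the digraph `Gs(A)` of thin semilattice edges. -/
def sReach (A : UAlgebra σ) : A.carrier → A.carrier → Prop :=
  Relation.ReflTransGen (fun x y => A.IsThinSLEdge x y)

/-- A maximal element of `Gs(A)`: an element of a maximal strongly connected
component. -/
def IsMaxElem (A : UAlgebra σ) (a : A.carrier) : Prop :=
  ∀ b, A.sReach a b → A.sReach b a

/-- A maximal component of `Gs(A)`: the strongly connected component of a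
maximal element. -/
def IsMaxComponent (A : UAlgebra σ) (C : Set A.carrier) : Prop :=
  ∃ a, A.IsMaxElem a ∧ C = {b | A.sReach a b ∧ A.sReach b a}

end UAlgebra

/-- An arc of the digraph `Gas(A)`: a thin semilattice or thin affine edge. -/
def asStep {σ : Signature} (𝒦 : Set (UAlgebra σ)) (A : UAlgebra σ)
    (x y : A.carrier) : Prop :=
  A.IsThinSLEdge x y ∨ IsThinAffEdge 𝒦 A x y

/-- Reachability in `Gas(A)`. -/
def asReach {σ : Signature} (𝒦 : Set (UAlgebra σ)) (A : UAlgebra σ) :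
    A.carrier → A.carrier → Prop :=
  Relation.ReflTransGen (asStep 𝒦 A)

/-- An as-maximal element: an element of an as-component. -/
def IsAsMaxElem {σ : Signature} (𝒦 : Set (UAlgebra σ)) (A : UAlgebra σ)
    (a : A.carrier) : Prop :=
  ∀ b, asReach 𝒦 A a b → asReach 𝒦 A b a

/-- An as-component of `A`: a maximal strongly connected component of `Gas(A)`. -/
def IsAsComponent {σ : Signature} (𝒦 : Set (UAlgebra σ)) (A : UAlgebra σ)
    (C : Set A.carrier) : Prop :=
  ∃ a, IsAsMaxElem 𝒦 A a ∧ C = {b | asReach 𝒦 A a b ∧ asReach 𝒦 A b a}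

namespace UAlgebra

variable {σ : Signature}

/-- Binary direct product. -/
def prod (A B : UAlgebra σ) : UAlgebra σ where
  carrier := A.carrier × B.carrier
  interp f x := (A.interp f fun j => (x j).1, B.interp f fun j => (x j).2)

/-- Direct product of a family. -/
def pi {ι : Type} (A : ι → UAlgebra σ) : UAlgebra σ where
  carrier := ∀ i, (A i).carrier
  interp f x := fun i => (A i).interp f fun j => x j i

/-- Homomorphism of similar algebras. -/
def IsHom (A B : UAlgebra σ) (φ : A.carrier → B.carrier) : Prop :=
  ∀ (f : σ.ops) (x : Fin (σ.arity f) → A.carrier),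
    φ (A.interp f x) = B.interp f fun j => φ (x j)

/-- Simple algebra: only the equality and full congruences. -/
def IsSimple (A : UAlgebra σ) : Prop :=
  ∀ θ : Congruence A, (∀ x y, θ.rel x y ↔ x = y) ∨ θ.IsFull

/-- Maximal generated algebra: generated by one of its maximal components. -/
def MaximalGenerated (A : UAlgebra σ) : Prop :=
  ∃ C : Set A.carrier, A.IsMaxComponent C ∧ A.ClosureSet C = Set.univ

/-- The number of subalgebras (nonempty closed subsets) of an algebra. -/
noncomputable def numSubalgebras (A : UAlgebra σ) : ℕ :=
  Nat.card {S : Set A.carrier // S.Nonempty ∧ A.IsClosed S}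

end UAlgebra

/-- A (k+3)-ary term is an edge term for a class `𝒦`. -/
def IsEdgeTermFor {σ : Signature} (𝒦 : Set (UAlgebra σ)) {k : ℕ}
    (t : Term σ (k + 3)) : Prop :=
  ∀ A ∈ 𝒦, ∀ x y : A.carrier,
    t.eval A (fun i => if i.val ≤ 1 then y else x) = x ∧
    t.eval A (fun i => if i.val = 0 ∨ i.val = 2 then y else x) = x ∧
    ∀ j : Fin (k + 3), 3 ≤ j.val →
      t.eval A (Function.update (fun _ => x) j y) = x

/-- A finite class has few subproducts. -/
def FewSubproducts {σ : Signature} (K : Set (UAlgebra σ)) : Prop :=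
  ∃ p : Polynomial ℕ, ∀ (n : ℕ) (A : Fin n → UAlgebra σ), (∀ i, A i ∈ K) →
    UAlgebra.numSubalgebras (UAlgebra.pi A) ≤ 2 ^ (p.eval n)

/-- `g_K` is bounded by a polynomial: every subalgebra of an `n`-fold product
of members of `K` has a generating set of polynomial size. -/
def PolyGenerated {σ : Signature} (K : Set (UAlgebra σ)) : Prop :=
  ∃ p : Polynomial ℕ, ∀ (n : ℕ) (A : Fin n → UAlgebra σ), (∀ i, A i ∈ K) →
    ∀ S : Set (UAlgebra.pi A).carrier, S.Nonempty → (UAlgebra.pi A).IsClosed S →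
      ∃ G : Set (UAlgebra.pi A).carrier, G ⊆ S ∧ G.Finite ∧
        G.ncard ≤ p.eval n ∧ (UAlgebra.pi A).ClosureSet G = S

namespace UAlgebra

variable {σ : Signature}

theorem ClosureSet_subset (A : UAlgebra σ) {S T : Set A.carrier} (h : S ⊆ A.ClosureSet T) :
    A.ClosureSet S ⊆ A.ClosureSet T := by
  intro x hx
  induction hx with
  | base hs => exact h hs
  | app f x _ ih => exact Closure.app f x ih

theorem ClosureSet_swap (A : UAlgebra σ) {S : Set (A.prod A).carrier}
    (hS : ∀ p ∈ S, Prod.swap p ∈ S) {p : (A.prod A).carrier}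
    (hp : p ∈ (A.prod A).ClosureSet S) :
    ((Prod.swap p : A.carrier × A.carrier) : (A.prod A).carrier) ∈ (A.prod A).ClosureSet S := by
  induction hp with
  | base hs => exact Closure.base (hS _ hs)
  | app f x _ ih =>
    exact Closure.app (A := A.prod A) f (fun j => (Prod.swap (x j) : A.carrier × A.carrier)) ih

theorem IsHom.eval {A B : UAlgebra σ} {φ : A.carrier → B.carrier} (hφ : IsHom A B φ)
    {n : ℕ} (t : Term σ n) (x : Fin n → A.carrier) :
    φ (t.eval A x) = t.eval B (fun i => φ (x i)) := by
  induction t with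
  | var i => rfl
  | app f ts ih =>
    simp only [Term.eval]
    rw [hφ]
    congr 1
    funext j
    exact ih j

theorem IsHom.isThinSLEdge {A B : UAlgebra σ} {φ : A.carrier → B.carrier} (hφ : IsHom A B φ)
    {a b : A.carrier} (h : A.IsThinSLEdge a b) : B.IsThinSLEdge (φ a) (φ b) := by
  obtain ⟨t, haa, hab, hba, hbb⟩ := h
  have key (x y : A.carrier) : t.eval B ![φ x, φ y] = φ (t.eval A ![x, y]) := by
    rw [hφ.eval]
    congr 1
    funext i
    fin_cases i <;> rfl
  exact ⟨t, by rw [key, haa], by rw [key, hab], by rw [key, hba], by rw [key, hbb]⟩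

theorem IsHom.sReach {A B : UAlgebra σ} {φ : A.carrier → B.carrier} (hφ : IsHom A B φ)
    {a b : A.carrier} (h : A.sReach a b) : B.sReach (φ a) (φ b) :=
  Relation.ReflTransGen.lift φ (fun _ _ => hφ.isThinSLEdge) _ _ h

/-- Every element of a finite algebra lies below a maximal one. -/
theorem exists_sReach_isMaxElem (A : UAlgebra σ) [Finite A.carrier] (a : A.carrier) :
    ∃ b, A.sReach a b ∧ A.IsMaxElem b := by
  let r : A.carrier → A.carrier → Prop := fun y x => A.sReach x y ∧ ¬ A.sReach y x
  have : IsTrans A.carrier r :=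
    ⟨fun x y z hxy hyz => ⟨hyz.1.trans hxy.1, fun h => hyz.2 (hxy.1.trans h)⟩⟩
  have : Std.Irrefl r := ⟨fun x h => h.2 h.1⟩
  have wf : WellFounded r := Finite.wellFounded_of_trans_of_irrefl r
  obtain ⟨b, hab, hb⟩ := wf.has_min {b | A.sReach a b} ⟨a, Relation.ReflTransGen.refl⟩
  refine ⟨b, hab, fun c hbc => ?_⟩
  by_contra hcb
  exact hb c (Relation.ReflTransGen.trans hab hbc) ⟨hbc, hcb⟩

theorem IsMaxComponent.nonempty {A : UAlgebra σ} {C : Set A.carrier} (hC : A.IsMaxComponent C) :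
    C.Nonempty := by
  obtain ⟨a, -, rfl⟩ := hC
  exact ⟨a, Relation.ReflTransGen.refl, Relation.ReflTransGen.refl⟩

theorem IsMaxComponent.mem_of_sReach {A : UAlgebra σ} {C : Set A.carrier}
    (hC : A.IsMaxComponent C) {a b : A.carrier} (ha : a ∈ C) (h : A.sReach a b) : b ∈ C := by
  obtain ⟨c, hc, rfl⟩ := hC
  have hcb : A.sReach c b := Relation.ReflTransGen.trans ha.1 h
  exact ⟨hcb, hc b hcb⟩

theorem IsMaxElem.congr_subalg {A : UAlgebra σ} {S T : Set A.carrier} (hS : A.IsClosed S)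
    (hT : A.IsClosed T) (hST : S = T) {x : A.carrier} (hxS : x ∈ S) (hxT : x ∈ T)
    (h : (A.subalg S hS).IsMaxElem ⟨x, hxS⟩) : (A.subalg T hT).IsMaxElem ⟨x, hxT⟩ := by
  subst hST
  exact h

end UAlgebra

/-- for maximal components `C1`, `C2` of a smooth finite
idempotent algebra omitting type 1, there are `a ∈ C1`, `b ∈ C2` such that
`(a,b)` is a maximal element of the subalgebra of `A × A` generated by
`{(a,b), (b,a)}`. -/
theorem stmt_10 (σ : Signature) (A : UAlgebra σ)
    (hfin : Finite A.carrier) (hne : Nonempty A.carrier) (hid : A.Idempotent)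
    (hsm : A.IsSmooth) (h1 : A.OmitsType1)
    (C1 C2 : Set A.carrier) (hC1 : A.IsMaxComponent C1) (hC2 : A.IsMaxComponent C2) :
    ∃ a ∈ C1, ∃ b ∈ C2,
      UAlgebra.IsMaxElem
        ((A.prod A).Sg {((a, b) : (A.prod A).carrier), ((b, a) : (A.prod A).carrier)})
        ((A.prod A).sgA ((a, b) : (A.prod A).carrier) ((b, a) : (A.prod A).carrier)) := by
  let G : A.carrier × A.carrier → Set (A.prod A).carrier := fun p =>
    {((p.1, p.2) : (A.prod A).carrier), ((p.2, p.1) : (A.prod A).carrier)}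
  have : Finite (A.prod A).carrier := inferInstanceAs (Finite (A.carrier × A.carrier))
  obtain ⟨a₀, ha₀⟩ := hC1.nonempty
  obtain ⟨b₀, hb₀⟩ := hC2.nonempty
  -- A pair generating a subalgebra of minimal size; moving up inside it changes nothing.
  obtain ⟨⟨a, b⟩, ⟨ha, hb⟩, hmin⟩ :=
    (Set.toFinite {p : A.carrier × A.carrier | p.1 ∈ C1 ∧ p.2 ∈ C2}).exists_minimalFor
      (fun p => ((A.prod A).ClosureSet (G p)).ncard) _ ⟨(a₀, b₀), ha₀, hb₀⟩
  have : Finite ((A.prod A).Sg (G (a, b))).carrier :=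
    inferInstanceAs (Finite {x // x ∈ (A.prod A).ClosureSet (G (a, b))})
  obtain ⟨⟨⟨c, d⟩, hcd⟩, hreach, hmax⟩ :=
    ((A.prod A).Sg (G (a, b))).exists_sReach_isMaxElem ((A.prod A).sgA (a, b) (b, a))
  have hc : c ∈ C1 := hC1.mem_of_sReach ha <|
    UAlgebra.IsHom.sReach (A := (A.prod A).Sg (G (a, b))) (B := A)
      (φ := fun x => x.1.1) (fun _ _ => rfl) hreach
  have hd : d ∈ C2 := hC2.mem_of_sReach hb <|
    UAlgebra.IsHom.sReach (A := (A.prod A).Sg (G (a, b))) (B := A)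
      (φ := fun x => x.1.2) (fun _ _ => rfl) hreach
  have hswap : ∀ p ∈ G (a, b), Prod.swap p ∈ G (a, b) := by
    rintro p (rfl | rfl)
    · exact Or.inr rfl
    · exact Or.inl rfl
  have hsub : (A.prod A).ClosureSet (G (c, d)) ⊆ (A.prod A).ClosureSet (G (a, b)) := by
    apply UAlgebra.ClosureSet_subset
    rintro p (rfl | rfl)
    · exact hcd
    · exact A.ClosureSet_swap hswap hcd
  have heq : (A.prod A).ClosureSet (G (c, d)) = (A.prod A).ClosureSet (G (a, b)) :=
    Set.eq_of_subset_of_ncard_le hsub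
      (hmin (j := (c, d)) ⟨hc, hd⟩ (Set.ncard_le_ncard hsub)) (Set.toFinite _)
  exact ⟨c, hc, d, hd, UAlgebra.IsMaxElem.congr_subalg _ _ heq.symm hcd _ hmax⟩
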